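/- arXiv:math/0611085 — 3 statements merged into one kernel-verified Lean document; each statement's English description precedes it below -/
import Mathlib

section
/- Let 𝔤 be a finite-dimensional semisimple Lie algebra over an algebraically closed field of characteristic 0 with an sl₂-triple (e,h,f), and let 𝔤(e), 𝔤(f) denote the centralizers of e and f. Then the restriction of the Killing form to 𝔤(e) × 𝔤(f) is non-degenerate; in particular 𝔤(f) is identified with the dual space of 𝔤(e). -/
noncomputable section

variable {K : Type} [Field K] [IsAlgClosed K] [CharZero K]
variable {L : Type} [LieRing L] [LieAlgebra K L] [Module.Finite K L]

/-- The centralizer `𝔤(e)` of an element, as a submodule. -/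
def cent (K : Type) {L : Type} [Field K] [LieRing L] [LieAlgebra K L] (e : L) :
    Submodule K L where
  carrier := {v : L | ⁅v, e⁆ = 0}
  add_mem' := by
    intro a b ha hb
    rw [Set.mem_setOf_eq] at *
    rw [add_lie, ha, hb, add_zero]
  zero_mem' := by simp
  smul_mem' := by
    intro c a ha
    rw [Set.mem_setOf_eq] at *
    rw [smul_lie, ha, smul_zero]

/-- The centralizer `𝔤(e)` of an element, as a Lie subalgebra. -/
def centLie (K : Type) {L : Type} [Field K] [LieRing L] [LieAlgebra K L] (e : L) :
    LieSubalgebra K L :=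
  { cent K e with
    lie_mem' := by
      intro x y hx hy
      change ⁅x, e⁆ = 0 at hx
      change ⁅y, e⁆ = 0 at hy
      change ⁅⁅x, y⁆, e⁆ = 0
      rw [lie_lie, hx, hy, lie_zero, lie_zero, sub_zero] }

/-- The weight space (in `L`) of weight `lam` for the adjoint action of the subspace `T`. -/
def wtSpace (T : Submodule K L) (lam : Module.Dual K L) : Submodule K L where
  carrier := {v : L | ∀ t ∈ T, ⁅t, v⁆ = lam t • v}
  add_mem' := by
    intro a b ha hb t ht
    rw [Set.mem_setOf_eq] at ha hb
    rw [lie_add, ha t ht, hb t ht, smul_add]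
  zero_mem' := by intro t ht; rw [lie_zero, smul_zero]
  smul_mem' := by
    intro c a ha t ht
    rw [Set.mem_setOf_eq] at ha
    rw [lie_smul, ha t ht, smul_comm]

/-- The centralizer `𝔞` of the subspace `T` in `L`, as a submodule. -/
def centT (T : Submodule K L) : Submodule K L := wtSpace T 0

/-- Weight space of the `T`-action on the centralizer `𝔤(e)`:  `E_λ` (resp. `F_λ` taking
`f` in place of `e`). -/
def EwtE (T : Submodule K L) (e : L) (lam : Module.Dual K L) : Submodule K L :=
  wtSpace T lam ⊓ cent K e

/-- The stabilizer `𝔤(e)(x)` of `x ∈ 𝔤(f) ≅ 𝔤(e)*` for the coadjoint action of `𝔤(e)`: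
the set of `v ∈ 𝔤(e)` with `κ(x, ⁅v, w⁆) = 0` for all `w ∈ 𝔤(e)`. -/
def coadStabE (e : L) (x : L) : Submodule K L where
  carrier := {v : L | v ∈ cent K e ∧ ∀ w ∈ cent K e, killingForm K L x ⁅v, w⁆ = 0}
  add_mem' := by
    intro a b ha hb
    refine ⟨Submodule.add_mem _ ha.1 hb.1, fun w hw => ?_⟩
    rw [add_lie, map_add, ha.2 w hw, hb.2 w hw, add_zero]
  zero_mem' := ⟨Submodule.zero_mem _, fun w hw => by rw [zero_lie, map_zero]⟩
  smul_mem' := by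
    intro c a ha
    refine ⟨Submodule.smul_mem _ c ha.1, fun w hw => ?_⟩
    rw [smul_lie, map_smul, ha.2 w hw, smul_eq_mul, mul_zero]

/-- An eigenvector `u` of `h` of weight `n+2` with `e f u = 0` vanishes. -/
lemma aux_chain {h e f : L} (ht : IsSl2Triple h e f) (n : ℕ) (u : L)
    (hu : ⁅h, u⁆ = ((n : K) + 2) • u) (hef : ⁅e, ⁅f, u⁆⁆ = 0) : u = 0 := by
  by_contra hne
  have hh : ∀ k : ℕ, ⁅h, ((LieModule.toEnd K L L e) ^ k) u⁆ =
      ((n : K) + 2 + 2 * k) • ((LieModule.toEnd K L L e) ^ k) u :=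
    fun k => ht.lie_h_pow_toEnd_e hu k
  have hf : ∀ k : ℕ, ⁅f, ((LieModule.toEnd K L L e) ^ (k + 1)) u⁆ =
      (-(((k : K) + 1) * ((n : K) + 2 + k))) • ((LieModule.toEnd K L L e) ^ k) u := by
    intro k
    have step : ∀ x : L, ⁅f, ⁅e, x⁆⁆ = ⁅e, ⁅f, x⁆⁆ - ⁅h, x⁆ := by
      intro x
      rw [leibniz_lie e f x, ht.lie_e_f]; abel
    induction k with
    | zero =>
      rw [pow_succ', Module.End.mul_apply, LieModule.toEnd_apply_apply, step, hh]
      simp only [pow_zero, Module.End.one_apply, hef]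
      rw [zero_sub, ← neg_smul]; congr 1; push_cast; ring
    | succ k ih =>
      rw [pow_succ', Module.End.mul_apply, LieModule.toEnd_apply_apply, step, hh, ih,
        lie_smul, IsSl2Triple.lie_e_pow_toEnd_e, ← sub_smul]
      congr 1; push_cast; ring
  have hnz : ∀ k : ℕ, ((LieModule.toEnd K L L e) ^ k) u ≠ 0 := by
    intro k
    induction k with
    | zero => simpa using hne
    | succ k ih =>
      intro h0
      have h1 := hf k
      rw [h0, lie_zero, eq_comm, smul_eq_zero] at h1
      rcases h1 with h1 | h1
      · rw [neg_eq_zero] at h1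
        have : (((k + 1) * (n + 2 + k) : ℕ) : K) = 0 := by push_cast; exact h1
        rw [Nat.cast_eq_zero] at this
        simp at this
      · exact ih h1
  have hinj : Function.Injective (fun k : ℕ => (n : K) + 2 + 2 * (k : K)) := fun a b hab ↦ by
    simpa using hab
  have key := Module.End.eigenvectors_linearIndependent' (LieModule.toEnd K L L h)
    (fun k : ℕ => (n : K) + 2 + 2 * (k : K)) hinj
    (fun k => ((LieModule.toEnd K L L e) ^ k) u)
    (fun k => ⟨Module.End.mem_eigenspace_iff.mpr (hh k), hnz k⟩)
  have hfin : Finite ℕ := key.finite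
  exact not_finite ℕ

lemma aux_disjoint (K : Type) [Field K] [IsAlgClosed K] [CharZero K]
    {L : Type} [LieRing L] [LieAlgebra K L] [Module.Finite K L] {h e f : L} (ht : IsSl2Triple h e f) (v : L)
    (hv : ⁅e, v⁆ = 0) (hr : ∃ u, ⁅f, u⁆ = v) : v = 0 := by
  have he2 := ht.lie_h_e_smul K
  have hf2 := ht.lie_lie_smul_f K
  by_contra hne
  let W : Submodule K L := LinearMap.ker (LieAlgebra.ad K L e) ⊓
    LinearMap.range (LieAlgebra.ad K L f)
  have hW : ∀ x ∈ W, LieAlgebra.ad K L h x ∈ W := by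
    rintro x ⟨hx1, u, rfl⟩
    refine ⟨?_, ⁅h, u⁆ - (2 : K) • u, ?_⟩
    · simp only [SetLike.mem_coe, LinearMap.mem_ker, LieAlgebra.ad_apply] at hx1 ⊢
      rw [leibniz_lie e h, hx1, lie_zero, ← lie_skew e h, he2, neg_lie,
        smul_lie, hx1]
      simp
    · simp only [LieAlgebra.ad_apply]
      rw [leibniz_lie h f u, hf2, lie_sub, lie_smul, neg_lie, smul_lie]; abel
  have : Nontrivial W := ⟨⟨v, hv, hr⟩, 0, fun hh => hne (congrArg Subtype.val hh)⟩
  obtain ⟨μ, hμ⟩ := Module.End.exists_eigenvalue ((LieAlgebra.ad K L h).restrict hW)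
  obtain ⟨⟨x, hx1, u, hu⟩, hx, hx0⟩ := hμ.exists_hasEigenvector
  rw [Module.End.mem_eigenspace_iff] at hx
  have hx := congrArg Subtype.val hx
  replace hx : ⁅h, x⁆ = μ • x := hx
  replace hx1 : ⁅e, x⁆ = 0 := hx1
  replace hu : ⁅f, u⁆ = x := hu
  replace hx0 : x ≠ 0 := fun h0 => hx0 (Subtype.ext h0)
  obtain ⟨n, rfl⟩ := (IsSl2Triple.HasPrimitiveVectorWith.mk (t := ht) hx0 hx hx1).exists_nat
  -- `h - (n+2)` is bijective on `ker f`
  let Z : Submodule K L := LinearMap.ker (LieAlgebra.ad K L f)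
  let T : L →ₗ[K] L := LieAlgebra.ad K L h - ((n : K) + 2) • LinearMap.id
  have hT : ∀ y, T y = ⁅h, y⁆ - ((n : K) + 2) • y := fun y => rfl
  have hfT : ∀ y, ⁅f, T y⁆ = ⁅h, ⁅f, y⁆⁆ - (n : K) • ⁅f, y⁆ := by
    intro y
    rw [hT, leibniz_lie h f y, hf2, lie_sub, lie_smul, neg_lie, smul_lie, add_smul]; abel
  have hZ : ∀ y ∈ Z, T y ∈ Z := by
    intro y hy
    replace hy : ⁅f, y⁆ = 0 := hy
    change ⁅f, T y⁆ = 0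
    rw [hfT, hy]; simp
  have hinj : Function.Injective (T.restrict hZ) := by
    rw [← LinearMap.ker_eq_bot, LinearMap.ker_eq_bot']
    rintro ⟨y, hy⟩ hy0
    replace hy0 : T y = 0 := congrArg Subtype.val hy0
    replace hy : ⁅f, y⁆ = 0 := hy
    by_contra hyne
    have hyne : y ≠ 0 := fun h0 => hyne (Subtype.ext h0)
    rw [hT, sub_eq_zero] at hy0
    obtain ⟨m, hm⟩ := (IsSl2Triple.HasPrimitiveVectorWith.mk (t := ht.symm)
      (μ := -((n : K) + 2)) hyne (by rw [neg_lie, hy0, neg_smul]) hy).exists_nat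
    have : ((m + n + 2 : ℕ) : K) = 0 := by push_cast; rw [← hm]; ring
    rw [Nat.cast_eq_zero] at this
    omega
  have hsurj := LinearMap.injective_iff_surjective.mp hinj
  have hTu : T u ∈ Z := by
    change ⁅f, T u⁆ = 0
    rw [hfT, hu, hx, sub_self]
  obtain ⟨⟨w, hw⟩, hw'⟩ := hsurj ⟨T u, hTu⟩
  replace hw' : T w = T u := congrArg Subtype.val hw'
  replace hw : ⁅f, w⁆ = 0 := hw
  have hfu : ⁅f, u - w⁆ = x := by rw [lie_sub, hu, hw, sub_zero]
  have h0 : u - w = 0 := by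
    refine aux_chain (K := K) ht n (u - w) ?_ (by rw [hfu, hx1])
    rw [← sub_eq_zero, ← hT, map_sub, hw', sub_self]
  rw [h0, lie_zero] at hfu
  exact hx0 hfu.symm

lemma aux_perp [LieAlgebra.IsSemisimple K L] (f v : L)
    (hv : ∀ w ∈ cent K f, killingForm K L v w = 0) : ∃ u, ⁅f, u⁆ = v := by
  have hB := LieAlgebra.IsKilling.killingForm_nondegenerate K L
  have hs := LieModule.traceForm_isSymm K L L
  have hR := hs.isRefl
  have h1 : v ∈ LinearMap.BilinForm.orthogonal (killingForm K L)
      (LinearMap.BilinForm.orthogonal (killingForm K L)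
        (LinearMap.range (LieAlgebra.ad K L f))) := by
    intro w hw
    refine hR _ _ (hv w ?_)
    change ⁅w, f⁆ = 0
    refine hB.1 _ fun y => ?_
    have := hw ⁅f, y⁆ ⟨y, rfl⟩
    have h2 : killingForm K L ⁅f, y⁆ w = 0 := this
    rw [LieModule.traceForm_apply_lie_apply, LieModule.traceForm_comm]
    exact h2
  rw [LinearMap.BilinForm.orthogonal_orthogonal hB hR] at h1
  exact h1

/-- For a finite-dimensional semisimple Lie algebra `𝔤` with an
`sl₂`-triple `(e,h,f)`, the restriction of the Killing form to `𝔤(e) × 𝔤(f)` is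
non-degenerate (so that `𝔤(f)` is identified with the dual of `𝔤(e)`). -/
theorem statement9 [LieAlgebra.IsSemisimple K L]
    {h e f : L} (ht : IsSl2Triple h e f) :
    (∀ v ∈ cent K e, (∀ w ∈ cent K f, killingForm K L v w = 0) → v = 0) ∧
    (∀ w ∈ cent K f, (∀ v ∈ cent K e, killingForm K L v w = 0) → w = 0) := by
  refine ⟨fun v hv hw => ?_, fun w hw hv => ?_⟩
  · refine aux_disjoint K ht v ?_ (aux_perp (K := K) f v hw)
    rw [← lie_skew, show ⁅v, e⁆ = 0 from hv, neg_zero]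
  · refine aux_disjoint K ht.symm w ?_ (aux_perp (K := K) e w fun v hv' => ?_)
    · rw [← lie_skew, show ⁅w, f⁆ = 0 from hw, neg_zero]
    · rw [LieModule.traceForm_comm]; exact hv v hv'
end
end

section
/- Let 𝔤 be a semisimple Lie algebra over an algebraically closed field of characteristic 0 with sl₂-triple (e,h,f), and let 𝔱 be an abelian subalgebra of 𝔩 = 𝔤(e)∩𝔤(f) acting semisimply. For λ ∈ 𝔱*, let E_λ and F_λ be the λ-weight spaces of the 𝔱-action on 𝔤(e) and 𝔤(f) respectively. Then dim E_λ = dim E_{-λ} = dim F_λ = dim F_{-λ}. -/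
noncomputable section

variable {K : Type} [Field K] [IsAlgClosed K] [CharZero K]
variable {L : Type} [LieRing L] [LieAlgebra K L] [Module.Finite K L]

/-- `ad e` is nilpotent for the nilpositive element of an `sl₂`-triple. -/
lemma ad_e_nilpotent {h e f : L} (ht : IsSl2Triple h e f) :
    IsNilpotent (LieAlgebra.ad K L e) := by
  by_contra hn
  have hne : ∀ n : ℕ, (LieAlgebra.ad K L e) ^ n ≠ 0 := fun n h0 => hn ⟨n, h0⟩
  set A := LieAlgebra.ad K L e with hA
  set H := LieAlgebra.ad K L h with hH
  have hHA : H * A - A * H = (2 : K) • A := by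
    ext x
    change ⁅h, ⁅e, x⁆⁆ - ⁅e, ⁅h, x⁆⁆ = (2 : K) • ⁅e, x⁆
    rw [← lie_lie, ht.lie_h_e_smul K, smul_lie]
  have key : ∀ n : ℕ, H * A ^ n - A ^ n * H = (2 * n : K) • A ^ n := by
    intro n
    induction n with
    | zero => simp
    | succ n ih =>
      have : H * A ^ (n + 1) - A ^ (n + 1) * H
          = (H * A ^ n - A ^ n * H) * A + A ^ n * (H * A - A * H) := by
        rw [pow_succ]; noncomm_ring
      rw [this, ih, hHA, smul_mul_assoc, mul_smul_comm, ← pow_succ, ← add_smul]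
      congr 1
      push_cast
      ring
  let Φ : Module.End K (Module.End K L) := LinearMap.mulLeft K H - LinearMap.mulRight K H
  have hev : ∀ n : ℕ, Φ.HasEigenvalue (2 * n : K) := fun n =>
    Module.End.hasEigenvalue_of_hasEigenvector (x := A ^ n)
      (Module.End.hasEigenvector_iff.mpr
        ⟨Module.End.mem_eigenspace_iff.mpr (by simpa [Φ] using key n), hne n⟩)
  have hinj : Function.Injective (fun n : ℕ => (2 * n : K)) := fun a b hab => by
    simpa using hab
  have hfin : Set.Finite {μ : K | Φ.HasEigenvalue μ} := Module.End.finite_hasEigenvalue Φ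
  exact (Set.infinite_range_of_injective hinj)
    (hfin.subset (by rintro _ ⟨n, rfl⟩; exact hev n))

/-- The rational structure on a Lie algebra in characteristic zero. -/
def ratModule (K L : Type) [Field K] [CharZero K] [LieRing L] [LieAlgebra K L] : Module ℚ L :=
  Module.compHom L (algebraMap ℚ K)

/-- The rational Lie algebra structure on a Lie algebra in characteristic zero. -/
def ratLie (K L : Type) [Field K] [CharZero K] [LieRing L] [LieAlgebra K L] : LieAlgebra ℚ L :=
  { ratModule K L with
    lie_smul := fun q x y => lie_smul (algebraMap ℚ K q) x y }

/-- The automorphism `exp (ad x)`, evaluated where `(ad x)^3` vanishes. -/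
lemma exists_exp (x : L) (hx : IsNilpotent (LieAlgebra.ad K L x)) :
    ∃ θ : L ≃ₗ⁅K⁆ L, ∀ y : L, ⁅x, ⁅x, ⁅x, y⁆⁆⁆ = 0 →
      θ y = y + ⁅x, y⁆ + (2 : K)⁻¹ • ⁅x, ⁅x, y⁆⁆ := by
  letI := ratLie K L
  have hD : (LieDerivation.ad K L x).toLinearMap = LieAlgebra.ad K L x := by
    ext y; simp
  have hx' : IsNilpotent (LieDerivation.ad K L x).toLinearMap := by rwa [hD]
  refine ⟨LieDerivation.exp (LieDerivation.ad K L x) hx', fun y hy => ?_⟩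
  rw [LieDerivation.exp_map_apply, hD]
  have h3 : ((LieAlgebra.ad K L x) ^ 3) • y = 0 := by
    simpa [pow_succ] using hy
  have := IsNilpotent.exp_smul_eq_sum h3 hx
  rw [Module.End.smul_def] at this
  rw [this]
  have hq : ∀ z : L, (2 : ℚ)⁻¹ • z = (2 : K)⁻¹ • z := fun z => by
    change (algebraMap ℚ K (2 : ℚ)⁻¹) • z = _
    simp
  simp [Finset.sum_range_succ, pow_succ, hq]

/-- The Weyl element: an automorphism sending `e` to `-f` and fixing the centralizer of the
triple. -/
lemma exists_weyl {h e f : L} (ht : IsSl2Triple h e f) :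
    ∃ θ : L ≃ₗ⁅K⁆ L, θ e = -f ∧ ∀ t : L, ⁅t, e⁆ = 0 → ⁅t, f⁆ = 0 → θ t = t := by
  obtain ⟨θ₁, h₁⟩ := exists_exp (K := K) e (ad_e_nilpotent ht)
  obtain ⟨θ₂, h₂⟩ := exists_exp (K := K) (-f) (by
    rw [map_neg]; exact (ad_e_nilpotent ht.symm).neg)
  have hef := ht.lie_e_f
  have hhe := ht.lie_h_e_smul K
  have hhf := ht.lie_lie_smul_f K
  have hfe : ⁅f, e⁆ = -h := by rw [← lie_skew, hef]
  have heh : ⁅e, h⁆ = -((2 : K) • e) := by rw [← lie_skew, hhe]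
  have hfh : ⁅f, h⁆ = (2 : K) • f := by rw [← lie_skew, hhf, neg_neg]
  have a1 : θ₁ e = e := by rw [h₁ e (by simp)]; simp
  have a2 : θ₁ h = h - (2 : K) • e := by
    rw [h₁ h (by simp [heh])]; simp [heh, sub_eq_add_neg]
  have a3 : θ₁ f = f + h - e := by
    rw [h₁ f (by simp [hef, heh])]
    simp [hef, heh, sub_eq_add_neg]
  have a4 : θ₂ e = e + h - f := by
    rw [h₂ e (by simp [hfe, hfh])]
    simp [hfe, hfh, sub_eq_add_neg]
  refine ⟨(θ₁.trans θ₂).trans θ₁, ?_, ?_⟩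
  · simp only [LieEquiv.trans_apply, a1, a4, map_add, map_sub, a2, a3]
    module
  · intro t hte htf
    have e1 : ⁅e, t⁆ = 0 := by rw [← lie_skew, hte, neg_zero]
    have f1 : ⁅f, t⁆ = 0 := by rw [← lie_skew, htf, neg_zero]
    have b1 : θ₁ t = t := by rw [h₁ t (by simp [e1])]; simp [e1]
    have b2 : θ₂ t = t := by rw [h₂ t (by simp [f1])]; simp [f1]
    simp [LieEquiv.trans_apply, b1, b2]

lemma finrank_E_le_F {h e f : L} (ht : IsSl2Triple h e f)
    (T : Submodule K L) (hTl : T ≤ cent K e ⊓ cent K f) (lam : Module.Dual K L) :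
    Module.finrank K (EwtE T e lam) ≤ Module.finrank K (EwtE T f lam) := by
  obtain ⟨θ, hθe, hθt⟩ := exists_weyl (K := K) ht
  have hmem : ∀ v ∈ EwtE T e lam, (θ : L →ₗ[K] L) v ∈ EwtE T f lam := by
    rintro v ⟨hv1, hv2⟩
    refine ⟨fun t htT => ?_, ?_⟩
    · have h1 : θ t = t := hθt t (hTl htT).1 (hTl htT).2
      have h2 : ⁅t, v⁆ = lam t • v := hv1 t htT
      have h3 := congrArg θ h2
      rw [LieEquiv.map_lie, h1, map_smul] at h3
      exact h3
    · have h2 : ⁅v, e⁆ = 0 := hv2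
      have h3 := congrArg θ h2
      rw [LieEquiv.map_lie, hθe, lie_neg, map_zero, neg_eq_zero] at h3
      exact h3
  refine LinearMap.finrank_le_finrank_of_injective
    (f := (θ : L →ₗ[K] L).restrict hmem) ?_
  intro a b hab
  have := congrArg Subtype.val hab
  exact Subtype.ext (θ.injective this)

lemma finrank_E_le_neg [LieAlgebra.IsSemisimple K L] {e f : L}
    (T : Submodule K L) (hTl : T ≤ cent K e ⊓ cent K f)
    (hss : (⨆ lam : Module.Dual K L, wtSpace T lam) = ⊤)
    (lam : Module.Dual K L) :
    Module.finrank K (EwtE T e lam) ≤ Module.finrank K (EwtE T e (-lam)) := by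
  -- nondegeneracy of the pairing of opposite weight spaces
  have hnd : ∀ v ∈ wtSpace T lam,
      (∀ w ∈ wtSpace T (-lam), killingForm K L v w = 0) → v = 0 := by
    intro v hv hvw
    have hall : (⊤ : Submodule K L) ≤ LinearMap.ker (killingForm K L v) := by
      rw [← hss]
      refine iSup_le fun μ w hw => ?_
      rw [LinearMap.mem_ker]
      by_cases hμ : ∀ t ∈ T, μ t = -lam t
      · refine hvw w fun t htT => ?_
        rw [hw t htT, hμ t htT, LinearMap.neg_apply]
      · push Not at hμ
        obtain ⟨t, htT, hne⟩ := hμ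
        have h1 : killingForm K L ⁅v, t⁆ w = killingForm K L v ⁅t, w⁆ :=
          LieModule.traceForm_apply_lie_apply K L L v t w
        rw [← lie_skew, hv t htT, hw t htT] at h1
        simp only [map_neg, map_smul, LinearMap.neg_apply, LinearMap.smul_apply,
          smul_eq_mul] at h1
        have h2 : (μ t + lam t) * killingForm K L v w = 0 := by linear_combination -h1
        exact (mul_eq_zero.mp h2).resolve_left fun h3 => hne (eq_neg_of_add_eq_zero_left h3)
    have hk : LinearMap.ker (killingForm K L) = ⊥ := LieAlgebra.IsKilling.ker_killingForm_eq_bot K L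
    have : v ∈ LinearMap.ker (killingForm K L) := by
      rw [LinearMap.mem_ker]
      ext w
      exact hall (Submodule.mem_top (x := w))
    rwa [hk, Submodule.mem_bot] at this
  have hst : ∀ w ∈ wtSpace T (-lam), LieAlgebra.ad K L e w ∈ wtSpace T (-lam) := by
    intro w hw t htT
    have hte : ⁅t, e⁆ = 0 := (hTl htT).1
    rw [LieAlgebra.ad_apply, leibniz_lie, hte, zero_lie, zero_add, hw t htT, lie_smul]
  let A : Module.End K (wtSpace T (-lam)) := (LieAlgebra.ad K L e).restrict hst
  let R : Submodule K (wtSpace T (-lam)) := LinearMap.range A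
  -- `E_λ` embeds in the annihilator of the range of `e` on the opposite weight space
  let Ψ : L →ₗ[K] Module.Dual K (wtSpace T (-lam)) :=
    (wtSpace T (-lam)).subtype.dualMap ∘ₗ killingForm K L
  have hΨ : ∀ v ∈ EwtE T e lam, Ψ v ∈ R.dualAnnihilator := by
    rintro v ⟨-, hv⟩
    rw [Submodule.mem_dualAnnihilator]
    rintro _ ⟨w, rfl⟩
    have hve : ⁅v, e⁆ = 0 := hv
    have h1 : killingForm K L ⁅v, e⁆ w = killingForm K L v ⁅e, (w : L)⁆ :=
      LieModule.traceForm_apply_lie_apply K L L v e w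
    rw [hve, map_zero, LinearMap.zero_apply] at h1
    exact h1.symm
  have hle : Module.finrank K (EwtE T e lam) ≤ Module.finrank K R.dualAnnihilator := by
    refine LinearMap.finrank_le_finrank_of_injective (f := Ψ.restrict hΨ) ?_
    rw [injective_iff_map_eq_zero]
    rintro ⟨v, hv⟩ h0
    have h0' : Ψ v = 0 := congrArg Subtype.val h0
    refine Subtype.ext (hnd v hv.1 fun w hw => ?_)
    exact LinearMap.congr_fun h0' ⟨w, hw⟩
  have hker : Module.finrank K (LinearMap.ker A) ≤ Module.finrank K (EwtE T e (-lam)) := by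
    have hm : ∀ w ∈ LinearMap.ker A, (wtSpace T (-lam)).subtype w ∈ EwtE T e (-lam) := by
      intro w hw
      refine ⟨w.2, ?_⟩
      have h1 : ⁅e, (w : L)⁆ = 0 := congrArg Subtype.val (LinearMap.mem_ker.mp hw)
      change ⁅(w : L), e⁆ = 0
      rw [← lie_skew, h1, neg_zero]
    refine LinearMap.finrank_le_finrank_of_injective
      (f := (wtSpace T (-lam)).subtype.restrict hm) ?_
    intro a b hab
    have hab' := congrArg (fun z : EwtE T e (-lam) => (z : L)) hab
    exact Subtype.ext (Subtype.ext hab')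
  have h1 := LinearMap.finrank_range_add_finrank_ker A
  have h2 := Subspace.finrank_add_finrank_dualAnnihilator_eq R
  change Module.finrank K R + _ = _ at h1
  omega

/-- `𝔤` semisimple with `sl₂`-triple `(e,h,f)`, `𝔱` an abelian
subalgebra of `𝔩 = 𝔤(e) ∩ 𝔤(f)` acting semisimply on `𝔤` (hypothesis `hss`).  For
every weight `λ`, the weight spaces `E_λ, E_{-λ} ⊆ 𝔤(e)` and `F_λ, F_{-λ} ⊆ 𝔤(f)` all
have the same dimension. -/
theorem statement13 [LieAlgebra.IsSemisimple K L] {h e f : L} (ht : IsSl2Triple h e f)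
    (T : Submodule K L) (hTl : T ≤ cent K e ⊓ cent K f)
    (habel : ∀ t ∈ T, ∀ t' ∈ T, ⁅t, t'⁆ = 0)
    (hss : (⨆ lam : Module.Dual K L, wtSpace T lam) = ⊤)
    (lam : Module.Dual K L) :
    Module.finrank K (EwtE T e lam) = Module.finrank K (EwtE T e (-lam)) ∧
    Module.finrank K (EwtE T e lam) = Module.finrank K (EwtE T f lam) ∧
    Module.finrank K (EwtE T e lam) = Module.finrank K (EwtE T f (-lam)) := by
  have hTl' : T ≤ cent K f ⊓ cent K e := fun t h => ⟨(hTl h).2, (hTl h).1⟩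
  have hEF : ∀ μ : Module.Dual K L,
      Module.finrank K (EwtE T e μ) = Module.finrank K (EwtE T f μ) := fun μ =>
    le_antisymm (finrank_E_le_F ht T hTl μ) (finrank_E_le_F ht.symm T hTl' μ)
  have hE : Module.finrank K (EwtE T e lam) = Module.finrank K (EwtE T e (-lam)) := by
    refine le_antisymm (finrank_E_le_neg T hTl hss lam) ?_
    have := finrank_E_le_neg T hTl hss (-lam)
    rwa [neg_neg] at this
  exact ⟨hE, hEF lam, hE.trans (hEF (-lam))⟩
end
end

section
/- With 𝔤 semisimple, (e,h,f) an sl₂-triple, and 𝔱 ⊆ 𝔩 = 𝔤(e)∩𝔤(f) acting semisimply: for each λ ∈ 𝔱*, the eigenvalues of ad h restricted to E_λ coincide, with multiplicities, with those of ad h restricted to E_{-λ}, where E_μ denotes the μ-weight space of 𝔱 acting on 𝔤(e). -/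
noncomputable section

variable {K : Type} [Field K] [IsAlgClosed K] [CharZero K]
variable {L : Type} [LieRing L] [LieAlgebra K L] [Module.Finite K L]

section Helpers14

open Module Polynomial

variable {V : Type} [AddCommGroup V] [Module K V]

lemma h14_comm (H E F : End K V) (hEF : E * F = F * E + H) (hHF : H * F = F * H - 2 * F) (k : ℕ) :
    E * F ^ (k + 1) = F ^ (k + 1) * E + (k + 1 : End K V) * (F ^ k * (H - (k : End K V))) := by
  induction k with
  | zero => simp [hEF]
  | succ k ih =>
    have c1 : (k : End K V) * F = F * k := (Nat.cast_commute k F).eq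
    have e1 : (H - (k : End K V)) * F = F * (H - 2 - k) := by
      rw [sub_mul, hHF, c1]; noncomm_ring
    have e2 : ((k : End K V) + 1) * F ^ (k + 1) = F ^ (k + 1) * (k + 1) := by
      have := (Nat.cast_commute (k + 1) (F ^ (k + 1))).eq
      push_cast at this; exact this
    have e3 : ((k : End K V) + 1 + 1) * F ^ (k + 1) = F ^ (k + 1) * (k + 1 + 1) := by
      have := (Nat.cast_commute (k + 1 + 1) (F ^ (k + 1))).eq
      push_cast at this; exact this
    have e4 : (k : End K V) * H = H * k := (Nat.cast_commute k H).eq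
    calc E * F ^ (k + 1 + 1) = (E * F ^ (k + 1)) * F := by rw [pow_succ, mul_assoc]
      _ = F ^ (k + 1) * (E * F) + (k + 1 : End K V) * (F ^ k * ((H - (k : End K V)) * F)) := by
        rw [ih]; noncomm_ring
      _ = F ^ (k + 1) * (F * E + H) + ((k + 1 : End K V) * F ^ (k + 1)) * (H - 2 - k) := by
        rw [hEF, e1, pow_succ F k]; simp only [mul_assoc]
      _ = F ^ (k + 1 + 1) * E + (F ^ (k + 1) * (k + 1 + 1)) * (H - (k + 1)) := by
        rw [e2, pow_succ F (k + 1), mul_assoc, mul_assoc, mul_assoc, ← mul_add, ← mul_add,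
          add_assoc]
        congr 2
        have e5 : (k : End K V) * 2 = 2 * k := (Nat.cast_commute k (2 : End K V)).eq
        simp only [mul_add, add_mul, mul_sub, e4, e5, one_mul, mul_one, two_mul]
        rw [← one_add_one_eq_two]
        abel
      _ = _ := by rw [← e3]; push_cast; simp only [mul_assoc]

/-- `∏_{i<k} (X - i)` -/
def h14P (K : Type) [Field K] (k : ℕ) : K[X] := ∏ i ∈ Finset.range k, (X - C (i : K))

lemma h14_prod (H E F : End K V) (hEF : E * F = F * E + H) (hHF : H * F = F * H - 2 * F)
    (hHE : H * E = E * H + 2 * E) (k : ℕ) :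
    ∀ z : V, F (E z) = 0 →
      (E ^ k) ((F ^ k) z) = (k.factorial : K) • (aeval H (h14P K k)) z := by
  induction k with
  | zero => intro z _; simp [h14P]
  | succ k ih =>
    intro z hz
    have hc : F * E * H = H * (F * E) := by
      have e2 : H * (F * E) = (F * H - 2 * F) * E := by rw [← hHF, mul_assoc]
      rw [e2, sub_mul, mul_assoc F H E, hHE, mul_add]
      noncomm_ring
    have hz' : F (E (H z - (k : K) • z)) = 0 := by
      have := LinearMap.congr_fun hc z
      simp only [Module.End.mul_apply] at this
      rw [map_sub, map_sub, this, hz, map_zero, map_smul, map_smul, hz]; simp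
    have h1 := LinearMap.congr_fun (h14_comm H E F hEF hHF k) z
    have h0 : (F ^ (k + 1)) (E z) = 0 := by
      rw [pow_succ, Module.End.mul_apply, hz, map_zero]
    have h2 : E ((F ^ (k + 1)) z) = ((k : K) + 1) • (F ^ k) (H z - (k : K) • z) := by
      have h3 : E ((F ^ (k + 1)) z) = (F ^ (k + 1)) (E z) +
          ((k + 1 : End K V)) ((F ^ k) ((H - (k : End K V)) z)) := h1
      rw [h3, h0, zero_add, LinearMap.sub_apply, LinearMap.add_apply, Module.End.one_apply,
        Module.End.natCast_apply, Module.End.natCast_apply, add_smul, one_smul,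
        Nat.cast_smul_eq_nsmul, Nat.cast_smul_eq_nsmul]
    rw [pow_succ E, Module.End.mul_apply, h2, map_smul, ih _ hz', h14P, h14P,
      Finset.prod_range_succ, map_mul, Module.End.mul_apply, smul_smul, Nat.factorial_succ]
    have h4 : (aeval H) (X - C (k : K)) z = H z - (k : K) • z := by
      rw [map_sub, aeval_X, aeval_C, LinearMap.sub_apply, Module.algebraMap_end_apply]
    rw [h4]
    push_cast
    rfl

lemma h14_nil [FiniteDimensional K V] (H F : End K V) (hHF : H * F = F * H - 2 * F) :
    ∃ N : ℕ, F ^ N = 0 := by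
  have key : ∀ k : ℕ, H * F ^ k = F ^ k * H - (2 * k : K) • F ^ k := by
    intro k
    induction k with
    | zero => simp
    | succ k ih =>
      rw [pow_succ, ← mul_assoc, ih, sub_mul, mul_assoc, hHF, mul_sub, smul_mul_assoc]
      have : F ^ k * (2 * F) = (2 : K) • (F ^ k * F) := by
        rw [two_mul, mul_add, two_smul]
      rw [this, sub_sub, ← add_smul, mul_assoc]
      push_cast; ring_nf
  by_contra! hN
  let A : End K (End K V) := LinearMap.mulLeft K H - LinearMap.mulRight K H
  have hev : ∀ k : ℕ, A.HasEigenvector (-(2 * k : K)) (F ^ k) := by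
    intro k
    refine ⟨Module.End.mem_eigenspace_iff.mpr ?_, hN k⟩
    simp [A, key k]
  have hinj : Function.Injective (fun k : ℕ => (-(2 * k : K))) := by
    intro a b hab
    simpa using hab
  have := Module.End.eigenvectors_linearIndependent' A _ hinj _ hev
  have := this.finite
  exact not_finite ℕ

lemma h14_maxGen (g : End K V) (hg : ⨆ μ, g.eigenspace μ = ⊤) (μ : K) :
    g.maxGenEigenspace μ ≤ g.eigenspace μ := by
  intro x hx
  have hx' : x ∈ g.eigenspace μ ⊔ ⨆ (ν) (_ : ν ≠ μ), g.eigenspace ν := by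
    have : (⊤ : Submodule K V) ≤ g.eigenspace μ ⊔ ⨆ (ν) (_ : ν ≠ μ), g.eigenspace ν := by
      rw [← hg]
      refine iSup_le fun ν => ?_
      by_cases h : ν = μ
      · subst h; exact le_sup_left
      · exact le_sup_of_le_right (le_iSup₂_of_le ν h le_rfl)
    exact this trivial
  have hle : ∀ ν, g.eigenspace ν ≤ g.maxGenEigenspace ν := fun ν =>
    (g.genEigenspace ν).mono le_top
  obtain ⟨a, ha, b, hb, rfl⟩ := Submodule.mem_sup.mp hx'
  have hb1 : b ∈ g.maxGenEigenspace μ := by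
    have := Submodule.sub_mem _ hx (hle μ ha)
    simpa using this
  have hb2 : b ∈ ⨆ (ν) (_ : ν ≠ μ), g.maxGenEigenspace ν :=
    (iSup₂_mono fun ν _ => hle ν) hb
  have : b = 0 := by
    have h := g.independent_maxGenEigenspace μ
    exact (Submodule.disjoint_def.mp h) b hb1 hb2
  rw [this, add_zero]; exact ha

end Helpers14

section Helpers14b

open Module Polynomial LieAlgebra

lemma h14_rel {h e f : L} (ht : IsSl2Triple h e f) :
    (ad K L e * ad K L f = ad K L f * ad K L e + ad K L h) ∧
    (ad K L h * ad K L f = ad K L f * ad K L h - 2 * ad K L f) ∧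
    (ad K L h * ad K L e = ad K L e * ad K L h + 2 * ad K L e) := by
  refine ⟨?_, ?_, ?_⟩ <;> ext x
  · simp only [Module.End.mul_apply, LinearMap.add_apply, ad_apply, ← ht.lie_e_f]
    rw [lie_lie]; abel
  · have := ht.lie_h_f_nsmul
    rw [two_mul]
    simp only [Module.End.mul_apply, LinearMap.add_apply, LinearMap.sub_apply, ad_apply]
    rw [leibniz_lie h f x, this, neg_lie, nsmul_lie, two_nsmul]; abel
  · have := ht.lie_h_e_nsmul
    rw [two_mul]
    simp only [Module.End.mul_apply, LinearMap.add_apply, LinearMap.sub_apply, ad_apply]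
    rw [leibniz_lie h e x, this, nsmul_lie, two_nsmul]; abel

lemma h14_inv (x y z : L) : killingForm K L ⁅x, y⁆ z = - killingForm K L y ⁅x, z⁆ := by
  rw [← lie_skew, map_neg, LinearMap.neg_apply, LieModule.traceForm_apply_lie_apply]

lemma h14_range [IsSemisimple K L] (e p : L)
    (hp : ∀ y, ⁅e, y⁆ = 0 → killingForm K L p y = 0) : ∃ z, ⁅e, z⁆ = p := by
  have hnd := IsKilling.killingForm_nondegenerate K L
  have hsymm := LieModule.traceForm_isSymm K L L
  have hr : LinearMap.BilinForm.IsRefl (killingForm K L) := hsymm.isRefl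
  have : p ∈ LinearMap.range (ad K L e) := by
    rw [← LinearMap.BilinForm.orthogonal_orthogonal hnd hr (LinearMap.range (ad K L e))]
    intro y hy
    rw [LieModule.traceForm_comm]
    apply hp
    apply hnd.2
    intro w
    have h1 : killingForm K L ⁅e, w⁆ y = 0 := hy _ ⟨w, rfl⟩
    rw [h14_inv] at h1
    simpa using h1
  obtain ⟨z, hz⟩ := this
  exact ⟨z, hz⟩

/-- Each `y ∈ 𝔤(e)` is a sum of joint eigenvectors in `𝔤(e)`. -/
lemma h14_decomp {h e f : L} (ht : IsSl2Triple h e f)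
    (T : Submodule K L) (hTl : T ≤ cent K e ⊓ cent K f)
    (habel : ∀ t ∈ T, ∀ t' ∈ T, ⁅t, t'⁆ = 0)
    (hss : (⨆ lam : Module.Dual K L, wtSpace T lam) = ⊤) (φ : L →ₗ[K] K)
    (hφ : ∀ y, ⁅e, y⁆ = 0 → ∀ (χ : L → K) (d : K), (∀ t ∈ T, ⁅t, y⁆ = χ t • y) → ⁅h, y⁆ = d • y →
      φ y = 0) : ∀ y, ⁅e, y⁆ = 0 → φ y = 0 := by
  obtain ⟨r1, r2, r3⟩ := h14_rel (K := K) ht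
  have hTe : ∀ t ∈ T, ⁅t, e⁆ = 0 := fun t h => (hTl h).1
  have hTf : ∀ t ∈ T, ⁅t, f⁆ = 0 := fun t h => (hTl h).2
  have hTh : ∀ t ∈ T, ⁅t, h⁆ = 0 := fun t h' => by
    rw [← ht.lie_e_f, leibniz_lie, hTe t h', hTf t h']; simp
  let M : Submodule K L := LinearMap.ker (ad K L e)
  let g : Option T → End K L := fun o => o.elim (ad K L h) (fun t => ad K L t)
  have hgM : ∀ o, ∀ x ∈ M, g o x ∈ M := by
    intro o x hx
    have hx' : ⁅e, x⁆ = 0 := hx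
    change ⁅e, g o x⁆ = 0
    cases o with
    | none =>
      change ⁅e, ⁅h, x⁆⁆ = 0
      rw [leibniz_lie, hx', ← lie_skew e h, ht.lie_h_e_nsmul]; simp [hx']
    | some t =>
      change ⁅e, ⁅(t : L), x⁆⁆ = 0
      rw [leibniz_lie, hx', ← lie_skew e (t : L), hTe t t.2]; simp
  let gM : Option T → End K M := fun o => (g o).restrict (hgM o)
  have hdiag : ∀ o, ⨆ μ, (gM o).eigenspace μ = ⊤ := by
    intro o
    cases o with
    | none =>
      apply Module.End.IsSemisimple.iSup_eigenspace_eq_top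
      obtain ⟨N, hN⟩ := h14_nil _ _ r2
      refine Module.End.isSemisimple_of_squarefree_aeval_eq_zero (p := h14P K N) ?_ ?_
      · apply Polynomial.Separable.squarefree
        apply Polynomial.separable_prod_X_sub_C_iff'.mpr
        intro a _ b _ hab
        exact_mod_cast hab
      · ext x
        have hx : (aeval (gM none) (h14P K N) x : L) = aeval (ad K L h) (h14P K N) (x : L) := by
          generalize h14P K N = q
          induction q using Polynomial.induction_on' with
          | add p q hp hq => simp only [map_add, LinearMap.add_apply, Submodule.coe_add, hp, hq]
          | monomial n a =>
            simp only [aeval_monomial, Module.End.mul_apply, Module.algebraMap_end_apply,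
              Submodule.coe_smul]
            congr 1
            induction n with
            | zero => simp
            | succ n ih => rw [pow_succ', pow_succ', Module.End.mul_apply, Module.End.mul_apply, ← ih]; rfl
        rw [hx]
        have h1 := h14_prod _ _ _ r1 r2 r3 N (x : L) (by
          have : ad K L e (x : L) = 0 := x.2
          rw [this, map_zero])
        rw [hN] at h1
        simp only [LinearMap.zero_apply, map_zero] at h1
        have h2 := (smul_eq_zero.mp h1.symm).resolve_left (by exact_mod_cast N.factorial_ne_zero)
        simpa using h2
    | some t =>
      apply Module.End.genEigenspace_restrict_eq_top
      rw [eq_top_iff, ← hss]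
      refine iSup_le fun μ => le_iSup_of_le (μ t) ?_
      intro v hv
      exact Module.End.mem_eigenspace_iff.mpr (hv t t.2)
  have hcomm : ∀ o o', Commute (gM o) (gM o') := by
    intro o o'
    have hc : ∀ a b : L, ⁅a, b⁆ = 0 → ∀ x : L, ⁅a, ⁅b, x⁆⁆ = ⁅b, ⁅a, x⁆⁆ := by
      intro a b hab x
      rw [leibniz_lie, hab]; simp
    have hht : ∀ t ∈ T, ⁅h, t⁆ = 0 := fun t h' => by rw [← lie_skew, hTh t h', neg_zero]
    ext x
    change g o (g o' x) = g o' (g o x)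
    cases o <;> cases o'
    · rfl
    · exact hc _ _ (hht _ (Subtype.property _)) _
    · exact hc _ _ (hTh _ (Subtype.property _)) _
    · exact hc _ _ (habel _ (Subtype.property _) _ (Subtype.property _)) _
  have htop := Module.End.iSup_iInf_maxGenEigenspace_eq_top_of_iSup_maxGenEigenspace_eq_top_of_commute
    gM (fun i j _ => hcomm i j) (fun i => by
      rw [eq_top_iff, ← hdiag i]
      exact iSup_mono fun μ => ((gM i).genEigenspace μ).mono le_top)
  have hle : (⊤ : Submodule K M) ≤ LinearMap.ker (φ ∘ₗ M.subtype) := by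
    rw [← htop]
    refine iSup_le fun χ => ?_
    intro y hy
    have hy' : ∀ o, g o y = χ o • (y : L) := by
      intro o
      have := h14_maxGen _ (hdiag o) _ (((Submodule.mem_iInf _).mp hy) o)
      exact congrArg Subtype.val (Module.End.mem_eigenspace_iff.mp this)
    classical
    refine hφ y y.2 (fun t => if ht : t ∈ T then χ (some ⟨t, ht⟩) else 0) (χ none) ?_ (hy' none)
    intro t ht
    simp only [ht, dif_pos]
    exact hy' (some ⟨t, ht⟩)
  intro y hy
  exact hle (show (⟨y, hy⟩ : M) ∈ ⊤ from trivial)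

lemma h14_le [LieAlgebra.IsSemisimple K L] {h e f : L} (ht : IsSl2Triple h e f)
    (T : Submodule K L) (hTl : T ≤ cent K e ⊓ cent K f)
    (habel : ∀ t ∈ T, ∀ t' ∈ T, ⁅t, t'⁆ = 0)
    (hss : (⨆ lam : Module.Dual K L, wtSpace T lam) = ⊤)
    (lam mu : Module.Dual K L) (hmu : mu = -lam) (c : K) :
    Module.finrank K ↥(EwtE T e lam ⊓ (LieAlgebra.ad K L h).eigenspace c) ≤
      Module.finrank K ↥(EwtE T e mu ⊓ (LieAlgebra.ad K L h).eigenspace c) := by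
  obtain ⟨r1, r2, r3⟩ := h14_rel (K := K) ht
  obtain ⟨N, hN⟩ := h14_nil _ _ r2
  have hTf : ∀ t ∈ T, ⁅t, f⁆ = 0 := fun t h => (hTl h).2
  have hkill : ∀ z : L, ⁅f, ⁅e, z⁆⁆ = 0 → aeval (ad K L h) (h14P K N) z = 0 := by
    intro z hz
    have h1 := h14_prod _ _ _ r1 r2 r3 N z hz
    rw [hN] at h1
    simp only [LinearMap.zero_apply, map_zero] at h1
    exact (smul_eq_zero.mp h1.symm).resolve_left (by exact_mod_cast N.factorial_ne_zero)
  have hev : ∀ (q : K[X]) (d : K) (v : L), ⁅h, v⁆ = d • v →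
      aeval (ad K L h) q v = q.eval d • v := by
    intro q d v hv
    exact Module.End.aeval_apply_of_mem_apply_eq_smul hv
  by_cases hbot : EwtE T e lam ⊓ (LieAlgebra.ad K L h).eigenspace c = ⊥
  · rw [hbot]; simp
  -- `c` is a natural number
  obtain ⟨n, rfl⟩ : ∃ n : ℕ, c = n := by
    obtain ⟨x, hx, hx0⟩ := (Submodule.ne_bot_iff _).mp hbot
    have hex : ⁅e, x⁆ = 0 := by
      have : ⁅x, e⁆ = 0 := hx.1.2
      rw [← lie_skew, this, neg_zero]
    have h1 := hkill x (by rw [hex, lie_zero])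
    rw [hev _ c x (Module.End.mem_eigenspace_iff.mp hx.2)] at h1
    have h2 := (smul_eq_zero.mp h1).resolve_right hx0
    rw [h14P, eval_prod, Finset.prod_eq_zero_iff] at h2
    obtain ⟨i, -, hi⟩ := h2
    exact ⟨i, by simpa [sub_eq_zero] using hi⟩
  set E1 := EwtE T e lam ⊓ (LieAlgebra.ad K L h).eigenspace (n : K)
  set E2 := EwtE T e mu ⊓ (LieAlgebra.ad K L h).eigenspace (n : K) with hE2
  let B : E1 →ₗ[K] Module.Dual K E2 :=
    (Submodule.subtype E2).dualMap ∘ₗ (killingForm K L) ∘ₗ ((ad K L f) ^ n) ∘ₗ E1.subtype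
  have hB : Function.Injective B := by
    rw [← LinearMap.ker_eq_bot, LinearMap.ker_eq_bot']
    rintro ⟨x, hx⟩ hBx
    have hB' : ∀ y ∈ E2, killingForm K L (((ad K L f) ^ n) x) y = 0 := fun y hy =>
      LinearMap.congr_fun hBx ⟨y, hy⟩
    have hex : ⁅e, x⁆ = 0 := by
      have : ⁅x, e⁆ = 0 := hx.1.2
      rw [← lie_skew, this, neg_zero]
    have hhx : ⁅h, x⁆ = (n : K) • x := Module.End.mem_eigenspace_iff.mp hx.2
    set p := ((ad K L f) ^ n) x with hp
    have hpow : ∀ k : ℕ, (∀ t ∈ T, ⁅t, ((ad K L f) ^ k) x⁆ = lam t • ((ad K L f) ^ k) x) ∧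
        ⁅h, ((ad K L f) ^ k) x⁆ = ((n : K) - 2 * k) • ((ad K L f) ^ k) x := by
      intro k
      induction k with
      | zero => exact ⟨fun t ht' => by simpa using hx.1.1 t ht', by simpa using hhx⟩
      | succ k ih =>
        rw [pow_succ', Module.End.mul_apply, ad_apply]
        refine ⟨fun t ht' => ?_, ?_⟩
        · rw [leibniz_lie, hTf t ht', ih.1 t ht', zero_lie, zero_add, lie_smul]
        · rw [leibniz_lie, ht.lie_h_f_nsmul, ih.2, lie_smul, neg_lie, nsmul_lie,
            ← Nat.cast_smul_eq_nsmul K, ← neg_smul, ← add_smul]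
          congr 1; push_cast; ring
    have hpT := (hpow n).1
    have hph : ⁅h, p⁆ = (-(n : K)) • p := by rw [(hpow n).2]; congr 1; ring
    rw [← hp] at hpT
    have hperp : ∀ y, ⁅e, y⁆ = 0 → killingForm K L p y = 0 := by
      refine h14_decomp ht T hTl habel hss (killingForm K L p) ?_
      intro y hy χ d hχ hd
      by_cases hcase : (∀ t ∈ T, χ t = mu t) ∧ d = n
      · apply hB'
        refine ⟨⟨fun t ht' => ?_, ?_⟩, Module.End.mem_eigenspace_iff.mpr ?_⟩
        · rw [hχ t ht', hcase.1 t ht']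
        · change ⁅y, e⁆ = 0
          rw [← lie_skew, hy, neg_zero]
        · rw [← hcase.2]; exact hd
      · have gen : ∀ (t : L) (a b : K), ⁅t, p⁆ = a • p → ⁅t, y⁆ = b • y → b ≠ -a →
            killingForm K L p y = 0 := by
          intro t a b ha hb hab
          have h1 := h14_inv (K := K) t p y
          rw [ha, hb, map_smul, LinearMap.smul_apply, map_smul, smul_eq_mul, smul_eq_mul] at h1
          have h2 : (b + a) * killingForm K L p y = 0 := by linear_combination h1
          exact (mul_eq_zero.mp h2).resolve_left (fun h' => hab (eq_neg_of_add_eq_zero_left h'))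
        rw [not_and_or] at hcase
        rcases hcase with hc | hc
        · push Not at hc
          obtain ⟨t, htT, hne⟩ := hc
          refine gen t _ _ (hpT t htT) (hχ t htT) ?_
          rw [hmu] at hne
          simpa using hne
        · exact gen h _ _ hph hd (by simpa using hc)
    obtain ⟨z, hz⟩ := h14_range e p hperp
    have hPne : (h14P K N).eval (-(n : K) - 2) ≠ 0 := by
      rw [h14P, eval_prod]
      refine Finset.prod_ne_zero_iff.mpr ?_
      intro i _ h2
      have h3 : ((n + 2 + i : ℕ) : K) = 0 := by
        simp only [eval_sub, eval_X, eval_C] at h2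
        push_cast; linear_combination -h2
      have := Nat.cast_eq_zero.mp h3
      omega
    -- `f^(n+1) x = 0`
    have hfx : ⁅f, p⁆ = 0 := by
      have hw : ⁅f, p⁆ = ((ad K L f) ^ (n + 1)) x := by
        rw [pow_succ', Module.End.mul_apply, ad_apply]
      have hhw : ⁅h, ⁅f, p⁆⁆ = (-(n : K) - 2) • ⁅f, p⁆ := by
        rw [hw, (hpow (n + 1)).2]; congr 1; push_cast; ring
      have hew : ⁅e, ⁅f, p⁆⁆ = 0 := by
        have h1 := LinearMap.congr_fun (h14_comm _ _ _ r1 r2 n) x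
        simp only [Module.End.mul_apply, LinearMap.add_apply, LinearMap.sub_apply, ad_apply,
          hex, hhx, map_zero, Module.End.natCast_apply, Nat.cast_smul_eq_nsmul, sub_self,
          smul_zero, Module.End.one_apply, add_zero] at h1
        rw [hw]; exact h1
      have h1 := hkill ⁅f, p⁆ (by rw [hew, lie_zero])
      rw [hev _ _ _ hhw] at h1
      exact (smul_eq_zero.mp h1).resolve_left hPne
    have hPz := hkill z (by rw [hz, hfx])
    have hshift : ∀ q : K[X], ⁅e, aeval (ad K L h) q z⁆ = q.eval (-(n : K) - 2) • p := by
      intro q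
      have hstep : ∀ v : L, ⁅e, ⁅h, v⁆⁆ = ⁅h, ⁅e, v⁆⁆ - (2 : K) • ⁅e, v⁆ := by
        intro v
        rw [leibniz_lie h e v, ht.lie_h_e_nsmul, nsmul_lie, ← Nat.cast_smul_eq_nsmul K]
        push_cast; abel
      induction q using Polynomial.induction_on' with
      | add a b ha hb => rw [map_add, LinearMap.add_apply, lie_add, ha, hb, eval_add, add_smul]
      | monomial k a =>
        rw [aeval_monomial, Module.End.mul_apply, Module.algebraMap_end_apply, lie_smul,
          eval_monomial, mul_smul]
        congr 1
        induction k with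
        | zero => simpa using hz
        | succ k ih =>
          rw [pow_succ', Module.End.mul_apply, ad_apply, hstep, ih, lie_smul, hph, smul_smul,
            smul_smul, ← sub_smul]
          congr 1; ring
    have hp0 : p = 0 := by
      have h1 := hshift (h14P K N)
      rw [hPz, lie_zero] at h1
      refine (smul_eq_zero.mp h1.symm).resolve_left ?_
      exact hPne
    have h1 := h14_prod _ _ _ r1 r2 r3 n x (by
      rw [ad_apply, ad_apply, hex, lie_zero])
    rw [← hp, hp0, map_zero, hev _ _ x hhx, smul_smul] at h1
    have h2 := (smul_eq_zero.mp h1.symm).resolve_left (by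
      refine mul_ne_zero (by exact_mod_cast n.factorial_ne_zero) ?_
      rw [h14P, eval_prod]
      refine Finset.prod_ne_zero_iff.mpr ?_
      intro i hi h2
      simp only [eval_sub, eval_X, eval_C, sub_eq_zero] at h2
      have := Nat.cast_injective h2
      simp at hi; omega)
    exact Subtype.ext h2
  calc _ ≤ Module.finrank K (Module.Dual K E2) := LinearMap.finrank_le_finrank_of_injective hB
    _ = _ := Subspace.dual_finrank_eq

end Helpers14b

/-- With `𝔤` semisimple, `(e,h,f)` an `sl₂`-triple and `𝔱 ⊆ 𝔩`
acting semisimply: for each weight `λ` and each scalar `c`, the `c`-eigenspace of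
`ad h` on `E_λ` has the same dimension as the `c`-eigenspace of `ad h` on `E_{-λ}`
(the eigenvalues of `ad h` on `E_λ` and on `E_{-λ}` coincide with multiplicities). -/
theorem statement14 [LieAlgebra.IsSemisimple K L] {h e f : L} (ht : IsSl2Triple h e f)
    (T : Submodule K L) (hTl : T ≤ cent K e ⊓ cent K f)
    (habel : ∀ t ∈ T, ∀ t' ∈ T, ⁅t, t'⁆ = 0)
    (hss : (⨆ lam : Module.Dual K L, wtSpace T lam) = ⊤)
    (lam : Module.Dual K L) (c : K) :
    Module.finrank K ↥(EwtE T e lam ⊓ (LieAlgebra.ad K L h).eigenspace c) =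
      Module.finrank K ↥(EwtE T e (-lam) ⊓ (LieAlgebra.ad K L h).eigenspace c) := by
  exact le_antisymm (h14_le ht T hTl habel hss lam (-lam) rfl c)
    (h14_le ht T hTl habel hss (-lam) lam (by simp) c)
end
end
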